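/- (Optimistic stitched value is an upper bound on the true value.) Assume that for every b ∈ B, |V^π_{(T,r)}(T(b, π(b))) − V^π_{(T,r)}(c(b))| ≤ ε(b). Then for every state s, V^π_{(T,r)}(s) ≤ V^π_{(T', r^+)}(s). -/

import Mathlib

/-- The trajectory of policy `π` in the deterministic MDP with transition `T`,
starting from `s`: `traj T π s 0 = s`, `traj T π s (k+1) = T (traj T π s k) (π (traj T π s k))`. -/
noncomputable def traj {S A : Type*} (T : S → A → S) (π : S → A) (s : S) : ℕ → S :=
  fun k => (fun x => T x (π x))^[k] s

/-- The value function of policy `π` with discount `γ`. -/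
noncomputable def V {S A : Type*} (T : S → A → S) (r : S → A → ℝ) (π : S → A)
    (γ : ℝ) (s : S) : ℝ :=
  ∑' k : ℕ, γ ^ k * r (traj T π s k) (π (traj T π s k))

open scoped Classical in
/-- The stitched transition function: `T'(s,a) = c(s)` if `s ∈ B` and `a = π(s)`, else `T(s,a)`. -/
noncomputable def Tstitch {S A : Type*} (T : S → A → S) (π : S → A) (B : Set S) (c : S → S) :
    S → A → S :=
  fun s a => if s ∈ B ∧ a = π s then c s else T s a

open scoped Classical in
/-- The pessimistic reward: `r⁻(s,a) = r(s,a) − γ·ε(s)` if `s ∈ B` and `a = π(s)`, else `r(s,a)`. -/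
noncomputable def rPess {S A : Type*} (r : S → A → ℝ) (π : S → A) (B : Set S) (ε : S → ℝ)
    (γ : ℝ) : S → A → ℝ :=
  fun s a => if s ∈ B ∧ a = π s then r s a - γ * ε s else r s a

open scoped Classical in
/-- The optimistic reward: `r⁺(s,a) = r(s,a) + γ·ε(s)` if `s ∈ B` and `a = π(s)`, else `r(s,a)`. -/
noncomputable def rOpt {S A : Type*} (r : S → A → ℝ) (π : S → A) (B : Set S) (ε : S → ℝ)
    (γ : ℝ) : S → A → ℝ :=
  fun s a => if s ∈ B ∧ a = π s then r s a + γ * ε s else r s a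

/-- Each discounted reward series with bounded rewards is summable. -/
theorem summable_aux {S A : Type*} (T : S → A → S) (r : S → A → ℝ) (π : S → A) (γ R : ℝ)
    (hγ0 : 0 ≤ γ) (hγ1 : γ < 1) (hR : ∀ s a, |r s a| ≤ R) (s : S) :
    Summable (fun k : ℕ => γ ^ k * r (traj T π s k) (π (traj T π s k))) := by
  refine Summable.of_norm_bounded ((summable_geometric_of_lt_one hγ0 hγ1).mul_right R) ?_
  intro k
  rw [Real.norm_eq_abs, abs_mul, abs_of_nonneg (pow_nonneg hγ0 k)]
  exact mul_le_mul_of_nonneg_left (hR _ _) (pow_nonneg hγ0 k)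

theorem V_bound_aux {S A : Type*} (T : S → A → S) (r : S → A → ℝ) (π : S → A) (γ R : ℝ)
    (hγ0 : 0 ≤ γ) (hγ1 : γ < 1) (hR : ∀ s a, |r s a| ≤ R) (s : S) :
    |V T r π γ s| ≤ (1 - γ)⁻¹ * R := by
  rw [← Real.norm_eq_abs]
  refine tsum_of_norm_bounded ((hasSum_geometric_of_lt_one hγ0 hγ1).mul_right R) ?_
  intro k
  rw [Real.norm_eq_abs, abs_mul, abs_of_nonneg (pow_nonneg hγ0 k)]
  exact mul_le_mul_of_nonneg_left (hR _ _) (pow_nonneg hγ0 k)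

/-- Bellman equation. -/
theorem V_bellman_aux {S A : Type*} (T : S → A → S) (r : S → A → ℝ) (π : S → A) (γ R : ℝ)
    (hγ0 : 0 ≤ γ) (hγ1 : γ < 1) (hR : ∀ s a, |r s a| ≤ R) (s : S) :
    V T r π γ s = r s (π s) + γ * V T r π γ (T s (π s)) := by
  unfold V
  rw [(summable_aux T r π γ R hγ0 hγ1 hR s).tsum_eq_zero_add, ← tsum_mul_left]
  congr 1
  · simp [traj]
  · refine tsum_congr fun k => ?_
    have h : traj T π s (k + 1) = traj T π (T s (π s)) k := by
      simp [traj, Function.iterate_succ_apply]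
    rw [h, pow_succ]
    ring

/-- Optimistic stitched value is an upper bound on the true value: if every stitch `b ∈ B`
satisfies `|V^π_{(T,r)}(T(b,π(b))) − V^π_{(T,r)}(c(b))| ≤ ε(b)`, then
`V^π_{(T,r)}(s) ≤ V^π_{(T',r⁺)}(s)` for every state `s` (where the optimistic stitched value
function is well defined, i.e. its defining series is summable). -/
theorem true_value_le_optimistic_stitched_value {S A : Type*}
    (T : S → A → S) (r : S → A → ℝ) (π : S → A) (γ R : ℝ)
    (hγ0 : 0 ≤ γ) (hγ1 : γ < 1) (hR : ∀ s a, |r s a| ≤ R)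
    (B : Set S) (c : S → S) (ε : S → ℝ) (hε0 : ∀ b ∈ B, 0 ≤ ε b)
    (hstitch : ∀ b ∈ B, |V T r π γ (T b (π b)) - V T r π γ (c b)| ≤ ε b)
    (hSum : ∀ s, Summable (fun k : ℕ =>
      γ ^ k * rOpt r π B ε γ (traj (Tstitch T π B c) π s k)
        (π (traj (Tstitch T π B c) π s k)))) :
    ∀ s, V T r π γ s ≤ V (Tstitch T π B c) (rOpt r π B ε γ) π γ s := by
  intro s
  have hstep : ∀ x, V T r π γ x ≤ rOpt r π B ε γ x (π x)
      + γ * V T r π γ (Tstitch T π B c x (π x)) := by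
    intro x
    rw [V_bellman_aux T r π γ R hγ0 hγ1 hR x]
    by_cases hx : x ∈ B
    · have h1 := (abs_le.mp (hstitch x hx)).2
      have h2 := mul_le_mul_of_nonneg_left h1 hγ0
      simp only [rOpt, Tstitch, hx, and_self, if_true]
      linarith
    · simp [rOpt, Tstitch, hx]
  have hpart : ∀ n : ℕ, V T r π γ s ≤
      (∑ k ∈ Finset.range n, γ ^ k * rOpt r π B ε γ (traj (Tstitch T π B c) π s k)
        (π (traj (Tstitch T π B c) π s k)))
      + γ ^ n * V T r π γ (traj (Tstitch T π B c) π s n) := by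
    intro n
    induction n with
    | zero => simp [traj]
    | succ n ih =>
      have h := mul_le_mul_of_nonneg_left (hstep (traj (Tstitch T π B c) π s n))
        (pow_nonneg hγ0 n)
      have ht : traj (Tstitch T π B c) π s (n + 1) = Tstitch T π B c
          (traj (Tstitch T π B c) π s n) (π (traj (Tstitch T π B c) π s n)) := by
        simp only [traj, Function.iterate_succ_apply']
      rw [Finset.sum_range_succ, ht, pow_succ]
      linarith
  have hlim0 : Filter.Tendsto (fun n : ℕ => γ ^ n * V T r π γ (traj (Tstitch T π B c) π s n))
      Filter.atTop (nhds 0) := by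
    have hg := (tendsto_pow_atTop_nhds_zero_of_lt_one hγ0 hγ1).mul_const ((1 - γ)⁻¹ * R)
    rw [zero_mul] at hg
    refine squeeze_zero_norm (fun n => ?_) hg
    rw [Real.norm_eq_abs, abs_mul, abs_of_nonneg (pow_nonneg hγ0 n)]
    exact mul_le_mul_of_nonneg_left (V_bound_aux T r π γ R hγ0 hγ1 hR _) (pow_nonneg hγ0 n)
  have hlim := (hSum s).hasSum.tendsto_sum_nat.add hlim0
  rw [add_zero] at hlim
  exact ge_of_tendsto' hlim hpart
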